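/- arXiv:2411.03817 — 6 statements merged into one kernel-verified Lean document; each statement's English description precedes it below -/
import Mathlib

section
/- Let σ(x) = 1 / (1 + exp(−x)) and let a > 0 and b > 0 be real numbers. Then the function γ ↦ a · log(σ(γ)) + b · log(1 − σ(γ)) on ℝ attains its supremum uniquely at γ* = log(a/b), and its supremum equals a · log(a/(a+b)) + b · log(b/(a+b)). -/
/-- Strict Gibbs inequality for two outcomes with unnormalized weights `a`, `b`. -/
lemma mul_log_add_mul_log_one_sub_lt {a b p : ℝ} (ha : 0 < a) (hb : 0 < b) (hp₀ : 0 < p)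
    (hp₁ : p < 1) (hp : p ≠ a / (a + b)) :
    a * Real.log p + b * Real.log (1 - p)
      < a * Real.log (a / (a + b)) + b * Real.log (b / (a + b)) := by
  have hq : 0 < a / (a + b) := by positivity
  have hr : 0 < b / (a + b) := by positivity
  have hp' : 0 < 1 - p := sub_pos.2 hp₁
  have h₁ := Real.log_lt_sub_one_of_pos (div_pos hp₀ hq) fun h => hp ((div_eq_one_iff_eq hq.ne').1 h)
  have h₂ := Real.log_le_sub_one_of_pos (div_pos hp' hr)
  rw [Real.log_div hp₀.ne' hq.ne'] at h₁
  rw [Real.log_div hp'.ne' hr.ne'] at h₂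
  have h₃ := mul_lt_mul_of_pos_left h₁ ha
  have h₄ := mul_le_mul_of_nonneg_left h₂ hb.le
  have h₅ : a * (p / (a / (a + b)) - 1) + b * ((1 - p) / (b / (a + b)) - 1) = 0 := by
    field_simp
    ring
  linarith

lemma sigmoid_log_div {a b : ℝ} (ha : 0 < a) (hb : 0 < b) :
    Real.sigmoid (Real.log (a / b)) = a / (a + b) := by
  rw [Real.sigmoid_def, Real.exp_neg, Real.exp_log (div_pos ha hb)]
  field_simp

/-- The function γ ↦ a·log(σ γ) + b·log(1 − σ γ), with σ the logistic function,
attains its supremum a·log(a/(a+b)) + b·log(b/(a+b)) uniquely at γ* = log(a/b). -/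
theorem logistic_reparametrized_discriminator (a b : ℝ) (ha : 0 < a) (hb : 0 < b) :
    (fun γ : ℝ => a * Real.log (1 / (1 + Real.exp (-γ)))
        + b * Real.log (1 - 1 / (1 + Real.exp (-γ)))) (Real.log (a / b))
      = a * Real.log (a / (a + b)) + b * Real.log (b / (a + b)) ∧
    IsGreatest (Set.range fun γ : ℝ => a * Real.log (1 / (1 + Real.exp (-γ)))
        + b * Real.log (1 - 1 / (1 + Real.exp (-γ))))
      (a * Real.log (a / (a + b)) + b * Real.log (b / (a + b))) ∧
    ∀ γ : ℝ, a * Real.log (1 / (1 + Real.exp (-γ)))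
        + b * Real.log (1 - 1 / (1 + Real.exp (-γ)))
        = a * Real.log (a / (a + b)) + b * Real.log (b / (a + b)) →
      γ = Real.log (a / b) := by
  have hσ : ∀ γ : ℝ, 1 / (1 + Real.exp (-γ)) = Real.sigmoid γ := fun γ => one_div _
  simp only [hσ]
  have hmax : a * Real.log (Real.sigmoid (Real.log (a / b)))
      + b * Real.log (1 - Real.sigmoid (Real.log (a / b)))
      = a * Real.log (a / (a + b)) + b * Real.log (b / (a + b)) := by
    rw [sigmoid_log_div ha hb, one_sub_div (add_pos ha hb).ne', add_sub_cancel_left]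
  have hlt : ∀ γ : ℝ, γ ≠ Real.log (a / b) →
      a * Real.log (Real.sigmoid γ) + b * Real.log (1 - Real.sigmoid γ)
        < a * Real.log (a / (a + b)) + b * Real.log (b / (a + b)) := fun γ hγ =>
    mul_log_add_mul_log_one_sub_lt ha hb (Real.sigmoid_pos γ) (Real.sigmoid_lt_one γ) fun h =>
      hγ (Real.sigmoid_injective (h.trans (sigmoid_log_div ha hb).symm))
  refine ⟨hmax, ⟨⟨_, hmax⟩, ?_⟩, fun γ h => ?_⟩
  · rintro _ ⟨γ, rfl⟩
    by_cases hγ : γ = Real.log (a / b)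
    · exact hγ ▸ hmax.le
    · exact (hlt γ hγ).le
  · by_contra hγ
    exact (hlt γ hγ).ne h
end

section
/- Let X be a finite nonempty type and let a, b : X → ℝ with a x > 0 and b x > 0 for all x. Then the supremum over all functions D : X → ℝ with 0 < D x < 1 for all x of ∑_{x ∈ X} (a x · log(D x) + b x · log(1 − D x)) equals ∑_{x ∈ X} (a x · log(a x/(a x + b x)) + b x · log(b x/(a x + b x))), and this supremum is attained at the function D*(x) = a x / (a x + b x). -/
/-- The tangent-line bound for `u * log t` at `t = u / s`. -/
theorem mul_log_le_mul_log_div_add {u s t : ℝ} (hu : 0 < u) (hs : 0 < s) (ht : 0 < t) :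
    u * Real.log t ≤ u * Real.log (u / s) + (s * t - u) := by
  have hus : 0 < u / s := div_pos hu hs
  have h := mul_le_mul_of_nonneg_left (Real.log_le_sub_one_of_pos (div_pos ht hus)) hu.le
  rw [Real.log_div ht.ne' hus.ne'] at h
  have he : u * (t / (u / s) - 1) = s * t - u := by field_simp
  linarith

/-- The supremum over discriminators D : X → (0,1) of
∑ x (a x · log(D x) + b x · log(1 − D x)) equals
∑ x (a x · log(a x/(a x + b x)) + b x · log(b x/(a x + b x))), attained at
D*(x) = a x/(a x + b x). -/
theorem optimal_discriminator_objective {X : Type*} [Fintype X] [Nonempty X]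
    (a b : X → ℝ) (ha : ∀ x, 0 < a x) (hb : ∀ x, 0 < b x) :
    IsGreatest
      {y : ℝ | ∃ D : X → ℝ, (∀ x, D x ∈ Set.Ioo (0 : ℝ) 1) ∧
        y = ∑ x, (a x * Real.log (D x) + b x * Real.log (1 - D x))}
      (∑ x, (a x * Real.log (a x / (a x + b x))
        + b x * Real.log (b x / (a x + b x)))) ∧
    (∀ x, a x / (a x + b x) ∈ Set.Ioo (0 : ℝ) 1) ∧
    ∑ x, (a x * Real.log (a x / (a x + b x))
        + b x * Real.log (1 - a x / (a x + b x)))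
      = ∑ x, (a x * Real.log (a x / (a x + b x))
        + b x * Real.log (b x / (a x + b x))) := by
  have hs : ∀ x, 0 < a x + b x := fun x => add_pos (ha x) (hb x)
  have hmem : ∀ x, a x / (a x + b x) ∈ Set.Ioo (0 : ℝ) 1 := fun x =>
    ⟨div_pos (ha x) (hs x), (div_lt_one (hs x)).2 (lt_add_of_pos_right _ (hb x))⟩
  have hsub : ∀ x, 1 - a x / (a x + b x) = b x / (a x + b x) := fun x => by
    rw [one_sub_div (hs x).ne', add_sub_cancel_left]
  refine ⟨⟨⟨fun x => a x / (a x + b x), hmem, by simp only [hsub]⟩, ?_⟩, hmem,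
    by simp only [hsub]⟩
  rintro y ⟨D, hD, rfl⟩
  refine Finset.sum_le_sum fun x _ => ?_
  have h₁ := mul_log_le_mul_log_div_add (ha x) (hs x) (hD x).1
  have h₂ := mul_log_le_mul_log_div_add (hb x) (hs x) (sub_pos.2 (hD x).2)
  linarith
end

section
/- Let X be a finite nonempty type and let a, b : X → ℝ with a x > 0 and b x > 0 for all x. Then the supremum over all functions c : X → ℝ with c x < 0 for all x of ∑_{x ∈ X} ((a x − b x) · c x) − ∑_{x ∈ X} b x · (−c x − log(1 − exp(c x))) equals the supremum over all functions D : X → ℝ with 0 < D x < 1 for all x of ∑_{x ∈ X} (a x · log(D x) + b x · log(1 − D x)); that is, the Fenchel conjugate of the cost regularizer ψ evaluated at a − b equals the optimal discriminator objective. -/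
/-- The Fenchel conjugate of the GAIL cost regularizer evaluated at a − b equals
the optimal-discriminator objective. -/
theorem fenchel_conjugate_eq_discriminator_objective {X : Type*} [Fintype X] [Nonempty X]
    (a b : X → ℝ) (ha : ∀ x, 0 < a x) (hb : ∀ x, 0 < b x) :
    sSup {y : ℝ | ∃ c : X → ℝ, (∀ x, c x < 0) ∧
        y = ∑ x, (a x - b x) * c x
          - ∑ x, b x * (-c x - Real.log (1 - Real.exp (c x)))}
      = sSup {y : ℝ | ∃ D : X → ℝ, (∀ x, D x ∈ Set.Ioo (0 : ℝ) 1) ∧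
        y = ∑ x, (a x * Real.log (D x) + b x * Real.log (1 - D x))} := by
  have objective_eq (c : X → ℝ) :
      ∑ x, (a x - b x) * c x - ∑ x, b x * (-c x - Real.log (1 - Real.exp (c x)))
        = ∑ x, (a x * Real.log (Real.exp (c x)) + b x * Real.log (1 - Real.exp (c x))) := by
    rw [← Finset.sum_sub_distrib]
    refine Finset.sum_congr rfl fun x _ => ?_
    rw [Real.log_exp]
    ring
  congr 1
  ext y
  constructor
  · rintro ⟨c, hc, rfl⟩
    exact ⟨fun x => Real.exp (c x), fun x => ⟨Real.exp_pos _, Real.exp_lt_one_iff.mpr (hc x)⟩,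
      objective_eq c⟩
  · rintro ⟨D, hD, rfl⟩
    refine ⟨fun x => Real.log (D x), fun x => Real.log_neg (hD x).1 (hD x).2, ?_⟩
    rw [objective_eq]
    simp only [Real.exp_log (hD _).1]
end

section
/- Let X be a finite nonempty type and let p, q be probability mass functions on X with p x > 0 and q x > 0 for all x. Let m = (p + q)/2. Then ∑_{x ∈ X} (p x · log(p x/(p x + q x)) + q x · log(q x/(p x + q x))) = KL(p‖m) + KL(q‖m) − 2 · log 2; in particular, the optimal-discriminator value of the objective ∑_x p x · log(D x) + q x · log(1 − D x) equals 2 · JS(p, q) − 2 · log 2 where JS(p, q) = ½ KL(p‖m) + ½ KL(q‖m). -/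
/-- Halving the denominator inside the logarithm adds `log 2`. -/
theorem mul_log_div_eq_mul_log_div_half_sub {a b : ℝ} (ha : a ≠ 0) (hb : b ≠ 0) :
    a * Real.log (a / b) = a * Real.log (a / (b / 2)) - a * Real.log 2 := by
  rw [Real.log_div ha hb, Real.log_div ha (div_ne_zero hb two_ne_zero),
    Real.log_div hb two_ne_zero]
  ring


/-- The optimal-discriminator value ∑ (p·log(p/(p+q)) + q·log(q/(p+q))) equals
KL(p‖m) + KL(q‖m) − 2·log 2 = 2·JS(p,q) − 2·log 2 with m = (p+q)/2. -/
theorem discriminator_value_eq_js {X : Type*} [Fintype X] [Nonempty X]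
    (p q : X → ℝ) (hp0 : ∀ x, 0 < p x) (hq0 : ∀ x, 0 < q x)
    (hp1 : ∑ x, p x = 1) (hq1 : ∑ x, q x = 1) :
    (∑ x, (p x * Real.log (p x / (p x + q x)) + q x * Real.log (q x / (p x + q x)))
      = (∑ x, p x * Real.log (p x / ((p x + q x) / 2)))
        + (∑ x, q x * Real.log (q x / ((p x + q x) / 2)))
        - 2 * Real.log 2) ∧
    (∑ x, (p x * Real.log (p x / (p x + q x)) + q x * Real.log (q x / (p x + q x)))
      = 2 * ((1 / 2) * (∑ x, p x * Real.log (p x / ((p x + q x) / 2)))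
          + (1 / 2) * (∑ x, q x * Real.log (q x / ((p x + q x) / 2))))
        - 2 * Real.log 2) := by
  have key : ∑ x, (p x * Real.log (p x / (p x + q x)) + q x * Real.log (q x / (p x + q x)))
      = (∑ x, p x * Real.log (p x / ((p x + q x) / 2)))
        + (∑ x, q x * Real.log (q x / ((p x + q x) / 2))) - 2 * Real.log 2 := by
    have hs (x : X) : p x + q x ≠ 0 := (add_pos (hp0 x) (hq0 x)).ne'
    rw [Finset.sum_congr rfl fun x _ => congrArg₂ (· + ·)
      (mul_log_div_eq_mul_log_div_half_sub (hp0 x).ne' (hs x))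
      (mul_log_div_eq_mul_log_div_half_sub (hq0 x).ne' (hs x))]
    rw [Finset.sum_add_distrib, Finset.sum_sub_distrib, Finset.sum_sub_distrib,
      ← Finset.sum_mul, ← Finset.sum_mul, hp1, hq1]
    ring
  exact ⟨key, key.trans (by ring)⟩
end

section
/- Let A be a finite nonempty type, let π_ref be a probability mass function on A with π_ref a > 0 for all a, let r : A → ℝ, and let β > 0. Define Z = ∑_{a ∈ A} π_ref a · exp(r a / β) and π*(a) = π_ref a · exp(r a / β) / Z. Then for every a ∈ A, r a = β · log(π* a / π_ref a) + β · log Z; that is, the reward function can be expressed through the optimal policy, the reference policy, and the partition function. -/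
/-- The reward can be expressed through the optimal policy, the reference
policy, and the partition function: r a = β·log(π* a / π_ref a) + β·log Z. -/
theorem reward_from_optimal_policy {A : Type*} [Fintype A] [Nonempty A]
    (πref : A → ℝ) (href0 : ∀ a, 0 < πref a) (href1 : ∑ a, πref a = 1)
    (r : A → ℝ) (β : ℝ) (hβ : 0 < β) :
    ∀ a : A,
      r a = β * Real.log ((πref a * Real.exp (r a / β)
              / (∑ a', πref a' * Real.exp (r a' / β))) / πref a)
        + β * Real.log (∑ a', πref a' * Real.exp (r a' / β)) := by
  intro a
  have hZ : 0 < ∑ a', πref a' * Real.exp (r a' / β) :=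
    Finset.sum_pos (fun a' _ => mul_pos (href0 a') (Real.exp_pos _)) Finset.univ_nonempty
  set Z := ∑ a', πref a' * Real.exp (r a' / β)
  have hratio : πref a * Real.exp (r a / β) / Z / πref a = Real.exp (r a / β) / Z := by
    rw [mul_div_assoc, mul_div_cancel_left₀ _ (href0 a).ne']
  rw [hratio, Real.log_div (Real.exp_pos _).ne' hZ.ne', Real.log_exp, mul_sub,
    mul_div_cancel₀ (r a) hβ.ne', sub_add_cancel]
end

section
/- Let A be a finite nonempty type, let π_ref be a probability mass function on A with π_ref a > 0 for all a, let r : A → ℝ, and let β > 0. Define Z = ∑_{a ∈ A} π_ref a · exp(r a / β), π*(a) = π_ref a · exp(r a / β) / Z, and σ(x) = 1/(1 + exp(−x)). Then for all a₁, a₂ ∈ A, σ(r a₁ − r a₂) = σ(β · log(π* a₁ / π_ref a₁) − β · log(π* a₂ / π_ref a₂)); that is, in the Bradley–Terry preference probability the partition function cancels, so preference probabilities are expressible purely through policy ratios. -/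
/-- The reward is recovered from a Gibbs policy `p * exp (x / β) / Z` up to the additive
constant `β * log Z`. -/
theorem mul_log_gibbs_ratio {p x β Z : ℝ} (hp : p ≠ 0) (hβ : β ≠ 0) (hZ : Z ≠ 0) :
    β * Real.log ((p * Real.exp (x / β) / Z) / p) = x - β * Real.log Z := by
  have h : (p * Real.exp (x / β) / Z) / p = Real.exp (x / β) / Z := by
    field_simp
  rw [h, Real.log_div (Real.exp_ne_zero _) hZ, Real.log_exp, mul_sub, mul_div_cancel₀ _ hβ]

/-- In the Bradley–Terry preference probability the partition function cancels:
σ(r a₁ − r a₂) = σ(β·log(π* a₁/π_ref a₁) − β·log(π* a₂/π_ref a₂)). -/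
theorem bradley_terry_partition_cancels {A : Type*} [Fintype A] [Nonempty A]
    (πref : A → ℝ) (href0 : ∀ a, 0 < πref a) (href1 : ∑ a, πref a = 1)
    (r : A → ℝ) (β : ℝ) (hβ : 0 < β) :
    ∀ a₁ a₂ : A,
      1 / (1 + Real.exp (-(r a₁ - r a₂)))
        = 1 / (1 + Real.exp (-(β * Real.log ((πref a₁ * Real.exp (r a₁ / β)
              / (∑ a', πref a' * Real.exp (r a' / β))) / πref a₁)
            - β * Real.log ((πref a₂ * Real.exp (r a₂ / β)
              / (∑ a', πref a' * Real.exp (r a' / β))) / πref a₂)))) := by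
  intro a₁ a₂
  have hZ : (∑ a', πref a' * Real.exp (r a' / β)) ≠ 0 :=
    (Finset.sum_pos (fun a _ => mul_pos (href0 a) (Real.exp_pos _)) Finset.univ_nonempty).ne'
  rw [mul_log_gibbs_ratio (href0 a₁).ne' hβ.ne' hZ, mul_log_gibbs_ratio (href0 a₂).ne' hβ.ne' hZ,
    sub_sub_sub_cancel_right]
end
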